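/- arXiv:1612.06144 — 2 statements merged into one kernel-verified Lean document; each statement's English description precedes it below -/
import Mathlib

section
/- Let (X,d) be a compact connected metric space, Λ a finite nonempty set, and ℱ = {X; f_λ | λ ∈ Λ} an IFS. If ℱ is chain transitive, then ℱ is chain mixing. -/
/-- An `ε`-chain of length `n` from `x` to `y` for the IFS `{X; f l | l : Λ}`:
points `c 0 = x, …, c n = y` together with indices `lam i` such that
`dist (f (lam i) (c i)) (c (i+1)) < ε` for all `i < n`. -/
def IFSChain {X Λ : Type*} [MetricSpace X] (f : Λ → X → X) (ε : ℝ) (n : ℕ)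
    (x y : X) : Prop :=
  ∃ (c : ℕ → X) (lam : ℕ → Λ), c 0 = x ∧ c n = y ∧
    ∀ i < n, dist (f (lam i) (c i)) (c (i + 1)) < ε

/-- The IFS is chain transitive: any point can be joined to any other point by an
`ε`-chain, for every `ε > 0`. -/
def IFSChainTransitive {X Λ : Type*} [MetricSpace X] (f : Λ → X → X) : Prop :=
  ∀ x y : X, ∀ ε : ℝ, 0 < ε → ∃ n : ℕ, 1 ≤ n ∧ IFSChain f ε n x y

/-- The IFS is chain mixing: for every `ε > 0` there is `N > 0` such that any two
points are joined by an `ε`-chain of length exactly `n`, for every `n > N`. -/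
def IFSChainMixing {X Λ : Type*} [MetricSpace X] (f : Λ → X → X) : Prop :=
  ∀ ε : ℝ, 0 < ε → ∃ N : ℕ, 0 < N ∧ ∀ x y : X, ∀ n : ℕ, N < n → IFSChain f ε n x y

/-- The IFS is chain recurrent: every point admits an `ε`-chain (of length `≥ 1`)
back to itself, for every `ε > 0`. -/
def IFSChainRecurrent {X Λ : Type*} [MetricSpace X] (f : Λ → X → X) : Prop :=
  ∀ x : X, ∀ ε : ℝ, 0 < ε → ∃ n : ℕ, 1 ≤ n ∧ IFSChain f ε n x x

/-- The maps of the IFS `ℱⁿ`: the composition `f (lam (n-1)) ∘ ⋯ ∘ f (lam 0)`. -/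
def iterMap {X Λ : Type*} (f : Λ → X → X) (n : ℕ) (lam : Fin n → Λ) : X → X :=
  fun x => (List.ofFn lam).foldl (fun y l => f l y) x

/-- The IFS is totally chain transitive: `ℱⁿ` is chain transitive for all `n ≥ 1`. -/
def IFSTotallyChainTransitive {X Λ : Type*} [MetricSpace X] (f : Λ → X → X) : Prop :=
  ∀ n : ℕ, 1 ≤ n → IFSChainTransitive (iterMap f n)

/-- For `σ = (λ_1, λ_2, …) ∈ Λ^ℕ`, `orbitIter f σ n = ℱ_{σ_n} = f_{λ_n} ∘ ⋯ ∘ f_{λ_1}`. -/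
def orbitIter {X Λ : Type*} (f : Λ → X → X) (σ : ℕ → Λ) : ℕ → X → X
  | 0 => id
  | n + 1 => fun x => f (σ n) (orbitIter f σ n x)

/-- The IFS is topologically mixing: for every pair of nonempty open sets `U, V`
there is `N` such that for every `n > N` some `ℱ_{σ_n}` maps `U` to meet `V`. -/
def IFSTopologicallyMixing {X Λ : Type*} [MetricSpace X] (f : Λ → X → X) : Prop :=
  ∀ U V : Set X, IsOpen U → IsOpen V → U.Nonempty → V.Nonempty →
    ∃ N : ℕ, ∀ n : ℕ, N < n → ∃ σ : ℕ → Λ, (orbitIter f σ n '' U ∩ V).Nonempty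

/-- The IFS has the shadowing property: every `δ`-pseudo-orbit is `ε`-shadowed by a
genuine orbit of the IFS. -/
def IFSShadowing {X Λ : Type*} [MetricSpace X] (f : Λ → X → X) : Prop :=
  ∀ ε : ℝ, 0 < ε → ∃ δ : ℝ, 0 < δ ∧ ∀ (c : ℕ → X) (lam : ℕ → Λ),
    (∀ i : ℕ, dist (f (lam i) (c i)) (c (i + 1)) < δ) →
    ∃ (σ : ℕ → Λ) (y : X), dist (c 0) y ≤ ε ∧
      ∀ n : ℕ, 1 ≤ n → dist (c n) (orbitIter f σ n y) ≤ ε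

lemma IFSChain.refl {X Λ : Type*} [MetricSpace X] [Nonempty Λ] (f : Λ → X → X) (ε : ℝ)
    (x : X) : IFSChain f ε 0 x x :=
  ⟨fun _ => x, fun _ => Classical.arbitrary Λ, rfl, rfl, by simp⟩

lemma IFSChain.single {X Λ : Type*} [MetricSpace X] {f : Λ → X → X} {ε : ℝ} {x y : X}
    (l : Λ) (hl : dist (f l x) y < ε) : IFSChain f ε 1 x y :=
  ⟨fun i => if i = 0 then x else y, fun _ => l, by simp, by simp, by simpa using hl⟩

lemma IFSChain.trans {X Λ : Type*} [MetricSpace X] {f : Λ → X → X} {ε : ℝ} {n m : ℕ}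
    {x y z : X} (h₁ : IFSChain f ε n x y) (h₂ : IFSChain f ε m y z) :
    IFSChain f ε (n + m) x z := by
  obtain ⟨c, lam, hc₀, hcn, hc⟩ := h₁
  obtain ⟨e, mu, he₀, hem, he⟩ := h₂
  refine ⟨fun i => if i < n then c i else e (i - n),
    fun i => if i < n then lam i else mu (i - n), ?_, by simpa using hem, fun i hi => ?_⟩
  · rcases Nat.eq_zero_or_pos n with rfl | hn
    · simp [he₀, ← hcn, hc₀]
    · simp [hn, hc₀]
  · rcases lt_trichotomy (i + 1) n with hlt | heq | hgt
    · simpa [hlt, Nat.lt_of_succ_lt hlt] using hc i (Nat.lt_of_succ_lt hlt)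
    · subst heq
      simpa [he₀, ← hcn] using hc i (Nat.lt_succ_self i)
    · have hni : n ≤ i := Nat.lt_succ_iff.mp hgt
      have hstep := he (i - n) (by omega)
      rw [← Nat.sub_add_comm hni] at hstep
      simpa [hni.not_gt, hgt.not_gt] using hstep

lemma IFSChain.isOpen_setOf_end {X Λ : Type*} [MetricSpace X] (f : Λ → X → X) (ε : ℝ)
    {n : ℕ} (hn : 1 ≤ n) (x : X) : IsOpen {y | IFSChain f ε n x y} := by
  obtain ⟨n, rfl⟩ := Nat.exists_eq_add_of_le' hn
  refine isOpen_iff_mem_nhds.mpr ?_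
  rintro y ⟨c, lam, hc₀, hcn, hc⟩
  have hnear : ∀ᶠ z in nhds y, dist (f (lam n) (c n)) z < ε :=
    (isOpen_lt (by fun_prop) continuous_const).mem_nhds
      (by simpa [hcn] using hc n (Nat.lt_succ_self n))
  filter_upwards [hnear] with z hz
  exact IFSChain.trans
    ⟨c, lam, hc₀, rfl, fun i hi => hc i (Nat.lt_succ_of_lt hi)⟩ (.single (lam n) hz)

lemma IFSChain.isOpen_setOf_start {X Λ : Type*} [MetricSpace X] {f : Λ → X → X}
    (hf : ∀ l, Continuous (f l)) (ε : ℝ) {n : ℕ} (hn : 1 ≤ n) (y : X) :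
    IsOpen {x | IFSChain f ε n x y} := by
  obtain ⟨n, rfl⟩ := Nat.exists_eq_add_of_le hn
  refine isOpen_iff_mem_nhds.mpr ?_
  rintro x ⟨c, lam, hc₀, hcn, hc⟩
  have hnear : ∀ᶠ z in nhds x, dist (f (lam 0) z) (c 1) < ε :=
    (isOpen_lt ((hf _).dist continuous_const) continuous_const).mem_nhds
      (by simpa [hc₀] using hc 0 (by omega))
  filter_upwards [hnear] with z hz
  refine IFSChain.trans (.single (lam 0) hz)
    ⟨fun i => c (1 + i), fun i => lam (1 + i), rfl, hcn, fun i hi => ?_⟩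
  exact hc (1 + i) (by omega)

/-- The lengths of `ε`-chains from `x` to itself. -/
def loopLengths {X Λ : Type*} [MetricSpace X] [Nonempty Λ] (f : Λ → X → X) (ε : ℝ) (x : X) :
    AddSubmonoid ℕ where
  carrier := {n | IFSChain f ε n x x}
  zero_mem' := IFSChain.refl f ε x
  add_mem' := IFSChain.trans

lemma setGcd_loopLengths_eq_one {X Λ : Type*} [MetricSpace X] [ConnectedSpace X] [Nonempty Λ]
    {f : Λ → X → X} (h : IFSChainTransitive f) {ε : ℝ} (hε : 0 < ε) (x : X) :
    Nat.setGcd (loopLengths f ε x : Set ℕ) = 1 := by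
  set k := Nat.setGcd (loopLengths f ε x : Set ℕ)
  have dvd_loop {n : ℕ} (hn : IFSChain f ε n x x) : k ∣ n := Nat.setGcd_dvd_of_mem hn
  let U (p : ℕ → Prop) : Set X := ⋃ n ∈ {n | 1 ≤ n ∧ p n}, {y | IFSChain f ε n x y}
  have isOpen_U (p : ℕ → Prop) : IsOpen (U p) :=
    isOpen_biUnion fun n hn => IFSChain.isOpen_setOf_end f ε hn.1 x
  have dvd_of_mem {y : X} (hy : y ∈ U (k ∣ ·)) {m : ℕ} (hm : IFSChain f ε m x y) : k ∣ m := by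
    simp only [U, Set.mem_iUnion₂] at hy
    obtain ⟨n, ⟨-, hkn⟩, hn⟩ := hy
    obtain ⟨p, -, hp⟩ := h y x ε hε
    have hkp : k ∣ p := (Nat.dvd_add_right hkn).mp (dvd_loop (hn.trans hp))
    exact (Nat.dvd_add_left hkp).mp (dvd_loop (hm.trans hp))
  have compl_U : (U (k ∣ ·))ᶜ = U (¬ k ∣ ·) := by
    ext y
    simp only [U, Set.mem_compl_iff, Set.mem_iUnion₂]
    constructor
    · intro hy
      obtain ⟨n, hn, hc⟩ := h x y ε hε
      exact ⟨n, ⟨hn, fun hk => hy ⟨n, ⟨hn, hk⟩, hc⟩⟩, hc⟩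
    · rintro ⟨m, ⟨-, hkm⟩, hm⟩ hy
      exact hkm (dvd_of_mem (by simpa only [U, Set.mem_iUnion₂] using hy) hm)
  have clopen : IsClopen (U (k ∣ ·)) :=
    ⟨isOpen_compl_iff.mp (compl_U ▸ isOpen_U _), isOpen_U _⟩
  have hne : (U (k ∣ ·)).Nonempty := by
    obtain ⟨n, hn, hc⟩ := h x x ε hε
    exact ⟨x, Set.mem_iUnion₂.mpr ⟨n, ⟨hn, dvd_loop hc⟩, hc⟩⟩
  let l : Λ := Classical.arbitrary Λ
  have hmem : f l x ∈ U (k ∣ ·) := clopen.eq_univ hne ▸ Set.mem_univ _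
  exact Nat.dvd_one.mp (dvd_of_mem hmem (.single l (by simpa using hε)))

lemma exists_bound_of_isOpen {X : Type*} [TopologicalSpace X] [CompactSpace X]
    {p : ℕ → X → Prop} (hp : ∀ n, 1 ≤ n → IsOpen {x | p n x})
    (hex : ∀ x, ∃ n, 1 ≤ n ∧ p n x) : ∃ N, ∀ x, ∃ n ≤ N, p n x := by
  choose n hn hpn using hex
  obtain ⟨t, ht⟩ := CompactSpace.elim_nhds_subcover (fun x => {y | p (n x) y})
    fun x => (hp (n x) (hn x)).mem_nhds (hpn x)
  refine ⟨t.sup n, fun y => ?_⟩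
  have hy : y ∈ ⋃ x ∈ t, {y | p (n x) y} := by rw [ht]; trivial
  obtain ⟨x, hx, hxy⟩ := Set.mem_iUnion₂.mp hy
  exact ⟨n x, Finset.le_sup hx, hxy⟩

/-- On a compact connected metric space, a chain transitive IFS is
chain mixing. -/
theorem ifs_chain_transitive_implies_chain_mixing
    {X Λ : Type*} [MetricSpace X] [CompactSpace X] [ConnectedSpace X]
    [Finite Λ] [Nonempty Λ]
    (f : Λ → X → X) (hf : ∀ l : Λ, Continuous (f l)) (h : IFSChainTransitive f) :
    IFSChainMixing f := by
  intro ε hε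
  obtain ⟨x₀⟩ : Nonempty X := inferInstance
  obtain ⟨L, hL⟩ := Nat.exists_mem_closure_of_ge (loopLengths f ε x₀ : Set ℕ)
  rw [setGcd_loopLengths_eq_one h hε, AddSubmonoid.closure_eq] at hL
  obtain ⟨A, hA⟩ := exists_bound_of_isOpen
    (fun n hn => IFSChain.isOpen_setOf_end f ε hn x₀) fun y => h x₀ y ε hε
  obtain ⟨B, hB⟩ := exists_bound_of_isOpen
    (fun n hn => IFSChain.isOpen_setOf_start hf ε hn x₀) fun x => h x x₀ ε hε
  refine ⟨A + B + L + 1, Nat.succ_pos _, fun x y n hn => ?_⟩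
  obtain ⟨a, ha, hay⟩ := hA y
  obtain ⟨b, hb, hbx⟩ := hB x
  have hloop : IFSChain f ε (n - a - b) x₀ x₀ := hL _ (by omega) (one_dvd _)
  have hlen : b + (n - a - b) + a = n := by omega
  exact hlen ▸ (hbx.trans hloop).trans hay
end

section
/- Let (X,d) be a compact connected metric space, Λ a finite nonempty set, and ℱ = {X; f_λ | λ ∈ Λ} an IFS of continuous maps. Then the following are equivalent: (1) ℱ is chain mixing; (2) ℱ is totally chain transitive; (3) ℱ is chain transitive; (4) ℱ is chain recurrent. -/
namespace IFSChain

variable {X Λ : Type*} [MetricSpace X] {f : Λ → X → X} {ε δ : ℝ} {m n : ℕ} {x y z : X}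

theorem mono (h : ε ≤ δ) : IFSChain f ε n x y → IFSChain f δ n x y
  | ⟨c, lam, h0, hn, hc⟩ => ⟨c, lam, h0, hn, fun i hi => (hc i hi).trans_le h⟩

theorem refl_s14 [Nonempty Λ] (f : Λ → X → X) (ε : ℝ) (x : X) : IFSChain f ε 0 x x :=
  ⟨fun _ => x, fun _ => Classical.arbitrary Λ, rfl, rfl, fun _ hi => absurd hi (Nat.not_lt_zero _)⟩

theorem eq_of_zero : IFSChain f ε 0 x y → x = y
  | ⟨_, _, h0, hn, _⟩ => h0.symm.trans hn

theorem snoc (h : IFSChain f ε n x y) {l : Λ} (hl : dist (f l y) z < ε) :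
    IFSChain f ε (n + 1) x z := by
  obtain ⟨c, lam, h0, hn, hc⟩ := h
  refine ⟨fun i => if i ≤ n then c i else z, fun i => if i < n then lam i else l,
    by simp [h0], by simp, fun i hi => ?_⟩
  rcases Nat.lt_succ_iff_lt_or_eq.1 hi with hi | rfl
  · simpa [hi, hi.le, Nat.succ_le_iff.2 hi] using hc i hi
  · simpa [hn] using hl

theorem split : IFSChain f ε (m + n) x z → ∃ y, IFSChain f ε m x y ∧ IFSChain f ε n y z
  | ⟨c, lam, h0, hn, hc⟩ =>
    ⟨c m, ⟨c, lam, h0, rfl, fun i hi => hc i (by lia)⟩,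
      ⟨fun i => c (m + i), fun i => lam (m + i), rfl, hn, fun i hi => hc (m + i) (by lia)⟩⟩

theorem exists_of_one : IFSChain f ε 1 x y → ∃ l, dist (f l x) y < ε
  | ⟨_, lam, h0, hn, hc⟩ => ⟨lam 0, by simpa [h0, hn] using hc 0 one_pos⟩

theorem trans_s14 (hxy : IFSChain f ε m x y) (hyz : IFSChain f ε n y z) :
    IFSChain f ε (m + n) x z := by
  induction n generalizing z with
  | zero => exact hyz.eq_of_zero ▸ hxy
  | succ n ih =>
    obtain ⟨w, hyw, hwz⟩ := hyz.split
    obtain ⟨l, hl⟩ := hwz.exists_of_one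
    exact (ih hyw).snoc hl

theorem single_s14 [Nonempty Λ] {l : Λ} (hl : dist (f l x) y < ε) : IFSChain f ε 1 x y := by
  simpa using (refl_s14 f ε x).snoc hl

/-- The endpoint of a nontrivial chain may be moved at the cost of a larger error. -/
theorem move_end (hn : 1 ≤ n) (h : IFSChain f ε n x y) (hyz : dist y z < δ) :
    IFSChain f (ε + δ) n x z := by
  obtain ⟨n, rfl⟩ := Nat.exists_eq_add_of_le' hn
  obtain ⟨w, hxw, hwy⟩ := h.split
  obtain ⟨l, hl⟩ := hwy.exists_of_one
  exact (hxw.mono (by linarith [dist_nonneg.trans_lt hyz])).snoc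
    ((dist_triangle _ y _).trans_lt (add_lt_add hl hyz))

theorem isOpen_setOf_end_s14 (f : Λ → X → X) (ε : ℝ) (hn : 1 ≤ n) (x : X) :
    IsOpen {y | IFSChain f ε n x y} := by
  obtain ⟨n, rfl⟩ := Nat.exists_eq_add_of_le' hn
  refine isOpen_iff_mem_nhds.2 fun y (hy : IFSChain f ε (n + 1) x y) => ?_
  obtain ⟨w, hxw, hwy⟩ := hy.split
  obtain ⟨l, hl⟩ := hwy.exists_of_one
  filter_upwards [(isOpen_lt (continuous_const.dist continuous_id) continuous_const).mem_nhds hl]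
    with z hz using hxw.snoc hz

theorem isOpen_setOf_start_s14 [Nonempty Λ] (hf : ∀ l, Continuous (f l)) (ε : ℝ) (hn : 1 ≤ n)
    (y : X) : IsOpen {x | IFSChain f ε n x y} := by
  obtain ⟨n, rfl⟩ := Nat.exists_eq_add_of_le hn
  refine isOpen_iff_mem_nhds.2 fun x (hx : IFSChain f ε (1 + n) x y) => ?_
  obtain ⟨w, hxw, hwy⟩ := hx.split
  obtain ⟨l, hl⟩ := hxw.exists_of_one
  filter_upwards [(isOpen_lt ((hf l).dist continuous_const) continuous_const).mem_nhds hl]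
    with z hz using (single_s14 hz).trans_s14 hwy

/-- The lengths of `ε`-chains from `x` to itself. -/
def loopLengths [Nonempty Λ] (f : Λ → X → X) (ε : ℝ) (x : X) : AddSubmonoid ℕ where
  carrier := {n | IFSChain f ε n x x}
  zero_mem' := refl_s14 f ε x
  add_mem' := trans_s14

theorem exists_iterMap_dist_lt [CompactSpace X] [Finite Λ] (hf : ∀ l, Continuous (f l)) (n : ℕ)
    (hε : 0 < ε) : ∃ δ > 0, ∀ x y, IFSChain f δ n x y →
      ∃ lam : Fin n → Λ, dist (iterMap f n lam x) y < ε := by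
  induction n generalizing ε with
  | zero =>
    exact ⟨1, one_pos, fun x y h => ⟨Fin.elim0, by simpa [iterMap, h.eq_of_zero] using hε⟩⟩
  | succ n ih =>
    have unif : ∀ l, ∃ η > 0, ∀ a b : X, dist a b < η → dist (f l a) (f l b) < ε / 2 := fun l => by
      obtain ⟨η, hη, h⟩ := Metric.uniformContinuous_iff.1
        (CompactSpace.uniformContinuous_of_continuous (hf l)) (ε / 2) (half_pos hε)
      exact ⟨η, hη, @h⟩
    choose η hη hfη using unif
    obtain ⟨η₀, hη₀, hle⟩ : ∃ η₀ > 0, ∀ l, η₀ ≤ η l := by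
      have h : ∀ᶠ t in nhdsWithin (0 : ℝ) (Set.Ioi 0), ∀ l, t ≤ η l :=
        Filter.eventually_all.2 fun l =>
          (eventually_le_nhds (hη l)).filter_mono nhdsWithin_le_nhds
      obtain ⟨t, ht, htpos⟩ := (h.and self_mem_nhdsWithin).exists
      exact ⟨t, htpos, ht⟩
    obtain ⟨δ, hδ, h⟩ := ih hη₀
    refine ⟨min δ (ε / 2), lt_min hδ (half_pos hε), fun x y hxy => ?_⟩
    obtain ⟨w, hxw, hwy⟩ := hxy.split
    obtain ⟨l, hl⟩ := hwy.exists_of_one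
    obtain ⟨lam, hlam⟩ := h x w (hxw.mono (min_le_left _ _))
    refine ⟨Fin.snoc lam l, ?_⟩
    have hiter : iterMap f (n + 1) (Fin.snoc lam l) x = f l (iterMap f n lam x) := by
      rw [iterMap, List.ofFn_succ_last]
      simp [iterMap]
    have h₁ := hfη l _ _ (hlam.trans_le (hle l))
    have h₂ := hl.trans_le (min_le_right _ _)
    rw [hiter]
    linarith [dist_triangle (f l (iterMap f n lam x)) (f l w) y]

theorem iterMap_of_mul [Nonempty Λ]
    (h : ∀ x y, IFSChain f δ n x y → ∃ lam : Fin n → Λ, dist (iterMap f n lam x) y < ε)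
    (hxy : IFSChain f δ (m * n) x y) : IFSChain (iterMap f n) ε m x y := by
  induction m generalizing y with
  | zero =>
    rw [zero_mul] at hxy
    exact hxy.eq_of_zero ▸ refl_s14 _ _ _
  | succ m ih =>
    rw [Nat.succ_mul] at hxy
    obtain ⟨w, hxw, hwy⟩ := hxy.split
    obtain ⟨lam, hlam⟩ := h w y hwy
    exact (ih hxw).snoc hlam

theorem of_iterMap_one : IFSChain (iterMap f 1) ε n x y → IFSChain f ε n x y
  | ⟨c, lam, h0, hn, hc⟩ => ⟨c, fun i => lam i 0, h0, hn, fun i hi => by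
      simpa [iterMap] using hc i hi⟩

end IFSChain

theorem Set.eq_univ_of_dist_lt_mem {X : Type*} [PseudoMetricSpace X] [PreconnectedSpace X]
    {S : Set X} {δ : ℝ} (hδ : 0 < δ) (hne : S.Nonempty)
    (h : ∀ y ∈ S, ∀ z, dist y z < δ → z ∈ S) : S = Set.univ := by
  refine IsClopen.eq_univ ⟨⟨?_⟩, ?_⟩ hne
  · refine Metric.isOpen_iff.2 fun y hy => ⟨δ, hδ, fun z hz hzS => hy (h z hzS y hz)⟩
  · exact Metric.isOpen_iff.2 fun y hy => ⟨δ, hδ, fun z hz => h y hy z (Metric.mem_ball'.1 hz)⟩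

section

variable {X Λ : Type*} [MetricSpace X] {f : Λ → X → X}

theorem IFSChainMixing.totallyChainTransitive [CompactSpace X] [Finite Λ] [Nonempty Λ]
    (hf : ∀ l, Continuous (f l)) (h : IFSChainMixing f) : IFSTotallyChainTransitive f := by
  intro n hn x y ε hε
  obtain ⟨δ, hδ, hδε⟩ := IFSChain.exists_iterMap_dist_lt hf n hε
  obtain ⟨N, -, hN⟩ := h δ hδ
  refine ⟨N + 1, by lia, IFSChain.iterMap_of_mul hδε (hN x y _ ?_)⟩
  exact Nat.lt_of_lt_of_le N.lt_succ_self (Nat.le_mul_of_pos_right _ hn)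

theorem IFSTotallyChainTransitive.chainTransitive (h : IFSTotallyChainTransitive f) :
    IFSChainTransitive f := fun x y ε hε =>
  (h 1 le_rfl x y ε hε).imp fun _ ⟨hn, hc⟩ => ⟨hn, hc.of_iterMap_one⟩

theorem IFSChainTransitive.chainRecurrent (h : IFSChainTransitive f) : IFSChainRecurrent f :=
  fun x => h x x

theorem IFSChainRecurrent.chainTransitive [ConnectedSpace X] (h : IFSChainRecurrent f) :
    IFSChainTransitive f := by
  intro x y ε hε
  suffices {y | ∃ n, 1 ≤ n ∧ IFSChain f ε n x y} = Set.univ from this.ge (Set.mem_univ y)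
  refine Set.eq_univ_of_dist_lt_mem (half_pos hε) ⟨x, h x ε hε⟩ ?_
  rintro y ⟨n, hn, hxy⟩ z hyz
  obtain ⟨m, hm, hyy⟩ := h y _ (half_pos hε)
  exact ⟨n + m, by lia, hxy.trans_s14 (by simpa using hyy.move_end hm hyz)⟩

theorem IFSChainTransitive.setGcd_loopLengths [ConnectedSpace X] [Nonempty Λ]
    (h : IFSChainTransitive f) {ε : ℝ} (hε : 0 < ε) (x : X) :
    Nat.setGcd (IFSChain.loopLengths f ε x : Set ℕ) = 1 := by
  set d := Nat.setGcd (IFSChain.loopLengths f ε x : Set ℕ)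
  have hd : ∀ {n}, IFSChain f ε n x x → d ∣ n := fun hn => Nat.setGcd_dvd_of_mem hn
  have huniv : {y | ∃ n, d ∣ n ∧ IFSChain f ε n x y} = Set.univ := by
    refine Set.eq_univ_of_dist_lt_mem (half_pos hε) ⟨x, 0, dvd_zero d, .refl f ε x⟩ ?_
    rintro y ⟨n, hn, hxy⟩ z hyz
    obtain ⟨m, hm, hyy⟩ := h y y _ (half_pos hε)
    obtain ⟨k, -, hyx⟩ := h y x ε hε
    have hm' : d ∣ m := by
      have h₁ := hd (hxy.trans_s14 hyx)
      have h₂ := hd ((hxy.trans_s14 (hyy.mono (half_le_self hε.le))).trans_s14 hyx)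
      rw [add_right_comm] at h₂
      exact (Nat.dvd_add_right h₁).1 h₂
    exact ⟨n + m, dvd_add hn hm', hxy.trans_s14 (by simpa using hyy.move_end hm hyz)⟩
  let l := Classical.arbitrary Λ
  obtain ⟨n, hn, hxy⟩ := huniv.ge (Set.mem_univ (f l x))
  obtain ⟨k, -, hyx⟩ := h (f l x) x ε hε
  have hstep : IFSChain f ε 1 x (f l x) := .single (l := l) (by simpa using hε)
  have hk : d ∣ k := (Nat.dvd_add_right hn).1 (hd (hxy.trans_s14 hyx))
  exact Nat.dvd_one.1 ((Nat.dvd_add_left hk).1 (hd (hstep.trans_s14 hyx)))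

theorem exists_nat_le_of_isOpen_cover [CompactSpace X] {U : ℕ → Set X}
    (hU : ∀ n, 1 ≤ n → IsOpen (U n)) (hcover : ∀ x, ∃ n, 1 ≤ n ∧ x ∈ U n) :
    ∃ K, ∀ x, ∃ n ≤ K, x ∈ U n := by
  obtain ⟨t, ht⟩ := isCompact_univ.elim_finite_subcover (fun n => U (n + 1))
    (fun n => hU _ (by lia)) fun x _ => by
      obtain ⟨n, hn, hx⟩ := hcover x
      exact Set.mem_iUnion.2 ⟨n - 1, by rwa [Nat.sub_add_cancel hn]⟩
  refine ⟨t.sup id + 1, fun x => ?_⟩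
  obtain ⟨n, hn, hx⟩ := Set.mem_iUnion₂.1 (ht (Set.mem_univ x))
  exact ⟨n + 1, Nat.succ_le_succ (Finset.le_sup (f := id) hn), hx⟩

theorem IFSChainTransitive.chainMixing [CompactSpace X] [ConnectedSpace X] [Nonempty Λ]
    (hf : ∀ l, Continuous (f l)) (h : IFSChainTransitive f) : IFSChainMixing f := by
  intro ε hε
  let p := Classical.arbitrary X
  obtain ⟨A, hA⟩ := exists_nat_le_of_isOpen_cover
    (fun n hn => IFSChain.isOpen_setOf_start_s14 (n := n) hf ε hn p) fun x => h x p ε hε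
  obtain ⟨B, hB⟩ := exists_nat_le_of_isOpen_cover
    (fun n hn => IFSChain.isOpen_setOf_end_s14 (n := n) f ε hn p) fun y => h p y ε hε
  obtain ⟨M, hM⟩ := Nat.exists_mem_closure_of_ge (IFSChain.loopLengths f ε p : Set ℕ)
  simp only [h.setGcd_loopLengths hε, one_dvd, AddSubmonoid.closure_eq, true_imp_iff] at hM
  refine ⟨A + B + M + 1, by lia, fun x y n hn => ?_⟩
  obtain ⟨a, ha, hxp⟩ := hA x
  obtain ⟨b, hb, hpy⟩ := hB y
  have hpp : IFSChain f ε (n - a - b) p p := hM _ (by lia)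
  have := (hxp.trans_s14 hpp).trans_s14 hpy
  rwa [show a + (n - a - b) + b = n by lia] at this

end

/-- For an IFS of continuous maps on a compact connected metric space,
the following are equivalent: (1) chain mixing; (2) totally chain transitive;
(3) chain transitive; (4) chain recurrent. -/
theorem ifs_chain_conditions_tfae
    {X Λ : Type*} [MetricSpace X] [CompactSpace X] [ConnectedSpace X]
    [Finite Λ] [Nonempty Λ]
    (f : Λ → X → X) (hf : ∀ l : Λ, Continuous (f l)) :
    List.TFAE [IFSChainMixing f, IFSTotallyChainTransitive f,
      IFSChainTransitive f, IFSChainRecurrent f] := by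
  tfae_have 1 → 2 := IFSChainMixing.totallyChainTransitive hf
  tfae_have 2 → 3 := IFSTotallyChainTransitive.chainTransitive
  tfae_have 3 → 4 := IFSChainTransitive.chainRecurrent
  tfae_have 4 → 1 := fun h => h.chainTransitive.chainMixing hf
  tfae_finish
end
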